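/- (Pouzet) Let L be a first-order language having only relation symbols and let X be an indivisible L-structure with domain ℕ. Then the poset ⟨P(X),⊆⟩ is atomless; in particular X contains two disjoint copies of itself, i.e. there exist A,B ∈ P(X) with no C ∈ P(X) satisfying C ⊆ A ∩ B. -/

import Mathlib

open FirstOrder

/-- For a relational language, every subset of an `L`-structure carries the induced structure. -/
instance setStructure (L : FirstOrder.Language) [L.IsRelational] {M : Type*} [L.Structure M]
    (s : Set M) : L.Structure s where
  funMap f _ := isEmptyElim f
  RelMap r x := Language.Structure.RelMap r (fun i => (x i : M))

/-- `Copies L M` is the family of domains of substructures of `M` isomorphic to `M`. -/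
def Copies (L : FirstOrder.Language) [L.IsRelational] (M : Type*) [L.Structure M] :
    Set (Set M) :=
  {A : Set M | Nonempty (L.Equiv A M)}

/-- `I_X`: the family of subsets of the domain containing no copy of the structure. -/
def CopiesIdeal (L : FirstOrder.Language) [L.IsRelational] (M : Type*) [L.Structure M] :
    Set (Set M) :=
  {S : Set M | ¬ ∃ A ∈ Copies L M, A ⊆ S}

/-- A structure is indivisible iff for every subset `S` of its domain it embeds into the induced
substructure on `S` or into the induced substructure on the complement of `S`. -/
def Indivisible (L : FirstOrder.Language) [L.IsRelational] (M : Type*) [L.Structure M] : Prop :=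
  ∀ S : Set M, Nonempty (L.Embedding M S) ∨ Nonempty (L.Embedding M ↥(Sᶜ))

/-- Two elements of a family `S` of sets (a poset under `⊆`) are compatible iff they have a
common lower bound in `S`. -/
def Compat {M : Type*} (S : Set (Set M)) (p q : Set M) : Prop :=
  ∃ r ∈ S, r ⊆ p ∧ r ⊆ q

/-- `p` is an atom of the poset `⟨S,⊆⟩` iff any two elements of `S` below `p` are compatible. -/
def IsForcingAtom {M : Type*} (S : Set (Set M)) (p : Set M) : Prop :=
  ∀ q ∈ S, q ⊆ p → ∀ r ∈ S, r ⊆ p → Compat S q r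

section

open Set Filter Topology MeasureTheory

/-- A compact metrizable space is Polish. -/
theorem polishSpace_of_compactSpace_metrizableSpace (α : Type*) [TopologicalSpace α]
    [CompactSpace α] [TopologicalSpace.MetrizableSpace α] : PolishSpace α := by
  let := TopologicalSpace.metrizableSpaceMetric α
  infer_instance

/-- Negating all coordinates from `n` on, as a self-homeomorphism of the Cantor space. -/
def tailFlip (n : ℕ) : (ℕ → Bool) ≃ₜ (ℕ → Bool) where
  toFun x i := if i < n then x i else !x i
  invFun x i := if i < n then x i else !x i
  left_inv x := by ext i; by_cases hi : i < n <;> simp [hi]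
  right_inv x := by ext i; by_cases hi : i < n <;> simp [hi]
  continuous_toFun := by
    refine continuous_pi fun i => ?_
    by_cases hi : i < n
    · simpa [hi] using continuous_apply i
    · simp only [hi, if_false]
      exact (continuous_of_discreteTopology (f := not)).comp (continuous_apply i)
  continuous_invFun := by
    refine continuous_pi fun i => ?_
    by_cases hi : i < n
    · simpa [hi] using continuous_apply i
    · simp only [hi, if_false]
      exact (continuous_of_discreteTopology (f := not)).comp (continuous_apply i)

theorem tailFlip_apply (n : ℕ) (x : ℕ → Bool) (i : ℕ) :
    tailFlip n x i = if i < n then x i else !x i := rfl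

/-- A nonprincipal ultrafilter on `ℕ` does not have the Baire property. -/
theorem not_baireMeasurableSet_of_le_cofinite {u : Ultrafilter ℕ}
    (hu : (u : Filter ℕ) ≤ cofinite) :
    ¬ BaireMeasurableSet {x : ℕ → Bool | {n | x n = true} ∈ u} := by
  intro hT
  obtain ⟨V, hVo, hTV⟩ := hT.residualEq_isOpen
  have hG := eventuallyEq_set.1 hTV
  have key : ∀ n, Dense {y : ℕ → Bool |
      ({k | y k = true} ∈ u ↔ y ∈ V) ∧ ({k | tailFlip n y k = true} ∈ u ↔ tailFlip n y ∈ V)} := by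
    intro n
    exact dense_of_mem_residual (hG.and
      ((tendsto_residual_of_isOpenMap (tailFlip n).continuous (tailFlip n).isOpenMap).eventually hG))
  rcases V.eq_empty_or_nonempty with rfl | ⟨x, hx⟩
  · obtain ⟨y, hy₁, hy₂⟩ := (key 0).nonempty
    simp only [mem_empty_iff_false, iff_false] at hy₁ hy₂
    apply hy₂
    rw [← Ultrafilter.compl_mem_iff_notMem] at hy₁
    filter_upwards [hy₁] with k hk
    simpa [tailFlip_apply] using hk
  · obtain ⟨n, hn⟩ : ∃ n, PiNat.cylinder x n ⊆ V := by
      obtain ⟨v, hv, hxv, hvV⟩ :=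
        (PiNat.isTopologicalBasis_cylinders (fun _ : ℕ => Bool)).exists_subset_of_mem_open hx hVo
      obtain ⟨z, n, rfl⟩ := hv
      exact ⟨n, (PiNat.mem_cylinder_iff_eq.1 hxv).subset.trans hvV⟩
    obtain ⟨y, hyc, hy₁, hy₂⟩ := (key n).inter_open_nonempty _
      (PiNat.isOpen_cylinder (fun _ : ℕ => Bool) x n) ⟨x, PiNat.self_mem_cylinder x n⟩
    have hy := hy₁.2 (hn hyc)
    have hfy := hy₂.2 (hn fun i hi => by simpa [tailFlip_apply, hi] using hyc i hi)
    have hfin : ∀ᶠ k in (u : Filter ℕ), ¬ k < n := hu (Set.finite_lt_nat n).eventually_cofinite_notMem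
    obtain ⟨k, hk₁, hk₂, hk₃⟩ := (hfin.and (Filter.Eventually.and hy hfy)).exists
    simp only [tailFlip_apply, hk₁, if_false] at hk₃
    simp_all

/-- A nonprincipal ultrafilter on `ℕ` is not an analytic subset of the Cantor space. -/
theorem not_analyticSet_of_le_cofinite {u : Ultrafilter ℕ} (hu : (u : Filter ℕ) ≤ cofinite) :
    ¬ AnalyticSet {x : ℕ → Bool | {n | x n = true} ∈ u} := by
  intro hT
  refine not_baireMeasurableSet_of_le_cofinite hu ?_
  have := polishSpace_of_compactSpace_metrizableSpace (ℕ → Bool)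
  borelize (ℕ → Bool)
  refine (hT.measurableSet_of_compl ?_).baireMeasurableSet
  convert hT.preimage (tailFlip 0).continuous using 1
  ext x
  simp only [mem_compl_iff, mem_ofPred_eq, mem_preimage, tailFlip_apply, Nat.not_lt_zero, if_false]
  rw [← Ultrafilter.compl_mem_iff_notMem]
  congr! 1
  ext k
  simp

/-- The upward closure of the ranges of a closed family of functions is analytic. -/
theorem analyticSet_range_subset {E : Set (ℕ → ℕ)} (hE : IsClosed E) :
    AnalyticSet {x : ℕ → Bool | ∃ f ∈ E, range f ⊆ {n | x n = true}} := by
  have hW : IsClosed {p : (ℕ → ℕ) × (ℕ → Bool) | p.1 ∈ E ∧ ∀ n, p.2 (p.1 n) = true} := by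
    refine (hE.preimage continuous_fst).inter ?_
    change IsClosed {p : (ℕ → ℕ) × (ℕ → Bool) | ∀ n, p.2 (p.1 n) = true}
    simp only [ofPred_forall]
    refine isClosed_iInter fun n => ?_
    have hev : Continuous fun q : (ℕ → Bool) × ℕ => q.1 q.2 :=
      continuous_prod_of_discrete_right.2 fun m => continuous_apply m
    exact isClosed_eq (hev.comp
      (continuous_snd.prodMk ((continuous_apply n).comp continuous_fst))) continuous_const
  have := polishSpace_of_compactSpace_metrizableSpace (ℕ → Bool)
  convert hW.analyticSet.image_of_continuous continuous_snd using 1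
  ext x
  simp [range_subset_iff]

/-- The self-embeddings of a structure, as a set of functions. -/
def selfEmbeddings (L : FirstOrder.Language) (M : Type*) [L.Structure M] : Set (M → M) :=
  {f | Function.Injective f ∧ ∀ (n : ℕ) (r : L.Relations n) (x : Fin n → M),
    FirstOrder.Language.Structure.RelMap r (f ∘ x) ↔ FirstOrder.Language.Structure.RelMap r x}

theorem isClosed_selfEmbeddings (L : FirstOrder.Language) (M : Type*) [L.Structure M]
    [TopologicalSpace M] [DiscreteTopology M] : IsClosed (selfEmbeddings L M) := by
  have hinj : IsClosed {f : M → M | Function.Injective f} := by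
    simp only [Function.Injective, ofPred_forall]
    refine isClosed_iInter fun a => isClosed_iInter fun b => ?_
    by_cases hab : a = b
    · simp [hab]
    · simp only [hab, imp_false]
      exact (isClosed_discrete {p : M × M | p.1 ≠ p.2}).preimage
        (f := fun f : M → M => (f a, f b)) ((continuous_apply a).prodMk (continuous_apply b))
  refine hinj.inter ?_
  change IsClosed {f : M → M | ∀ (n : ℕ) (r : L.Relations n) (x : Fin n → M),
    FirstOrder.Language.Structure.RelMap r (f ∘ x) ↔ FirstOrder.Language.Structure.RelMap r x}
  simp only [ofPred_forall]
  refine isClosed_iInter fun n => isClosed_iInter fun r => isClosed_iInter fun x => ?_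
  exact (isClosed_discrete {y : Fin n → M | FirstOrder.Language.Structure.RelMap r y ↔
    FirstOrder.Language.Structure.RelMap r x}).preimage (f := fun f : M → M => f ∘ x)
      (continuous_pi fun i => continuous_apply (x i))

theorem comp_mem_selfEmbeddings {L : FirstOrder.Language} {M : Type*} [L.Structure M]
    {f g : M → M} (hf : f ∈ selfEmbeddings L M) (hg : g ∈ selfEmbeddings L M) :
    f ∘ g ∈ selfEmbeddings L M :=
  ⟨hf.1.comp hg.1, fun n r x => (hf.2 n r (g ∘ x)).trans (hg.2 n r x)⟩

theorem mem_selfEmbeddings_of_comp {L : FirstOrder.Language} {M : Type*} [L.Structure M]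
    {f g : M → M} (hf : f ∈ selfEmbeddings L M) (hfg : f ∘ g ∈ selfEmbeddings L M) :
    g ∈ selfEmbeddings L M :=
  ⟨hfg.1.of_comp, fun n r x => (hf.2 n r (g ∘ x)).symm.trans (hfg.2 n r x)⟩

theorem exists_selfEmbedding_of_embedding {L : FirstOrder.Language} [L.IsRelational] {M : Type*}
    [L.Structure M] {S : Set M} (e : L.Embedding M S) :
    ∃ f ∈ selfEmbeddings L M, range f ⊆ S :=
  ⟨fun m => e m, ⟨Subtype.val_injective.comp e.injective, fun _ r x => e.map_rel r x⟩,
    range_subset_iff.2 fun m => (e m).2⟩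

theorem mem_copies_iff {L : FirstOrder.Language} [L.IsRelational] {M : Type*} [L.Structure M]
    {A : Set M} : A ∈ Copies L M ↔ ∃ f ∈ selfEmbeddings L M, range f = A := by
  constructor
  · rintro ⟨e⟩
    refine ⟨fun m => e.symm m, ⟨Subtype.val_injective.comp e.symm.injective,
      fun _ r x => e.symm.map_rel r x⟩, ?_⟩
    change range (Subtype.val ∘ e.symm) = A
    rw [range_comp, (FirstOrder.Language.Equiv.surjective e.symm).range_eq]
    simp
  · rintro ⟨f, hf, rfl⟩
    let e : L.Equiv M (range f) :=
      { Equiv.ofInjective f hf.1 with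
        map_fun' := fun g => isEmptyElim g
        map_rel' := fun r x => hf.2 _ r x }
    exact ⟨e.symm⟩

/-- If an indivisible structure has pairwise compatible copies, then the sets containing a copy
form an ultrafilter. -/
theorem exists_ultrafilter_of_compat {L : FirstOrder.Language} [L.IsRelational] {M : Type*}
    [Nonempty M] [L.Structure M] (h : Indivisible L M)
    (hc : ∀ f ∈ selfEmbeddings L M, ∀ g ∈ selfEmbeddings L M,
      ∃ c ∈ selfEmbeddings L M, range c ⊆ range f ∩ range g) :
    ∃ u : Ultrafilter M, ∀ S : Set M, S ∈ u ↔ ∃ f ∈ selfEmbeddings L M, range f ⊆ S := by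
  let F : Filter M :=
    { sets := {S | ∃ f ∈ selfEmbeddings L M, range f ⊆ S}
      univ_sets := ⟨id, ⟨Function.injective_id, fun _ _ _ => Iff.rfl⟩, subset_univ _⟩
      sets_of_superset := fun ⟨f, hf, hfS⟩ hST => ⟨f, hf, hfS.trans hST⟩
      inter_sets := by
        rintro S T ⟨f, hf, hfS⟩ ⟨g, hg, hgT⟩
        obtain ⟨c, hcE, hcr⟩ := hc f hf g hg
        exact ⟨c, hcE, hcr.trans (inter_subset_inter hfS hgT)⟩ }
  have hF : ∀ S : Set M, S ∈ F ↔ ∃ f ∈ selfEmbeddings L M, range f ⊆ S := fun _ => Iff.rfl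
  refine ⟨Ultrafilter.ofComplNotMemIff F fun S => ⟨fun hS => ?_, fun hS hSc => ?_⟩, hF⟩
  · rcases h S with ⟨⟨e⟩⟩ | ⟨⟨e⟩⟩
    · exact exists_selfEmbedding_of_embedding e
    · exact absurd (exists_selfEmbedding_of_embedding e) hS
  · have hbot := inter_mem hS hSc
    rw [inter_compl_self, hF] at hbot
    obtain ⟨f, -, hf⟩ := hbot
    exact hf (mem_range_self (Classical.arbitrary M))

/-- An indivisible structure on `ℕ` has two incompatible self-embeddings. -/
theorem exists_incompatible_selfEmbeddings {L : FirstOrder.Language} [L.IsRelational]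
    [L.Structure ℕ] (h : Indivisible L ℕ) :
    ∃ f ∈ selfEmbeddings L ℕ, ∃ g ∈ selfEmbeddings L ℕ,
      ∀ c ∈ selfEmbeddings L ℕ, ¬ range c ⊆ range f ∩ range g := by
  by_contra! hc
  obtain ⟨u, hu⟩ := exists_ultrafilter_of_compat h hc
  refine not_analyticSet_of_le_cofinite (u := u) ?_ ?_
  · rcases u.le_cofinite_or_eq_pure with hle | ⟨n, rfl⟩
    · exact hle
    · obtain ⟨f, hf, hfn⟩ := (hu {n}).1 (mem_singleton n)
      rw [range_subset_iff] at hfn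
      exact absurd (hf.1 ((hfn 0).trans (hfn 1).symm)) zero_ne_one
  · simpa only [hu] using analyticSet_range_subset (isClosed_selfEmbeddings L ℕ)

end

/-- (Pouzet) For a countable indivisible relational structure `X` the poset `⟨P(X),⊆⟩` is
atomless; in particular `X` contains two disjoint copies of itself, i.e. there are
`A, B ∈ P(X)` such that no `C ∈ P(X)` satisfies `C ⊆ A ∩ B`. -/
theorem indivisible_copies_atomless (L : FirstOrder.Language) [L.IsRelational]
    [L.Structure ℕ] (h : Indivisible L ℕ) :
    (∀ p ∈ Copies L ℕ, ¬ IsForcingAtom (Copies L ℕ) p) ∧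
    (∃ A ∈ Copies L ℕ, ∃ B ∈ Copies L ℕ, ¬ ∃ C ∈ Copies L ℕ, C ⊆ A ∩ B) := by
  obtain ⟨f, hf, g, hg, hfg⟩ := exists_incompatible_selfEmbeddings h
  refine ⟨fun p hp hatom => ?_, Set.range f, mem_copies_iff.2 ⟨f, hf, rfl⟩, Set.range g,
    mem_copies_iff.2 ⟨g, hg, rfl⟩, ?_⟩
  · obtain ⟨e, he, rfl⟩ := mem_copies_iff.1 hp
    obtain ⟨C, hC, hCf, hCg⟩ := hatom (Set.range (e ∘ f))
      (mem_copies_iff.2 ⟨_, comp_mem_selfEmbeddings he hf, rfl⟩) (Set.range_comp_subset_range f e)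
      (Set.range (e ∘ g)) (mem_copies_iff.2 ⟨_, comp_mem_selfEmbeddings he hg, rfl⟩)
      (Set.range_comp_subset_range g e)
    obtain ⟨c, hc, rfl⟩ := mem_copies_iff.1 hC
    choose a ha using fun n => hCf (Set.mem_range_self n)
    choose b hb using fun n => hCg (Set.mem_range_self n)
    have hfa : e ∘ (f ∘ a) = c := funext ha
    refine hfg (f ∘ a) (mem_selfEmbeddings_of_comp he (hfa ▸ hc)) ?_
    rintro _ ⟨n, rfl⟩
    exact ⟨Set.mem_range_self _, b n, he.1 ((hb n).trans (ha n).symm)⟩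
  · rintro ⟨C, hC, hCfg⟩
    obtain ⟨c, hc, rfl⟩ := mem_copies_iff.1 hC
    exact hfg c hc hCfg
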